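/- (Effective bulk modulus in equi-triaxial tension.) Let K > 0, η ∈ ℝ, and 0 ≤ d_H < 1. Let Φ = (1 − d_H)^{−1/2} Id (3×3), and let g(Φ) = (1 − η) + η[(1/10)(tr Φ)² + (1/30)tr(Φ²)]. Then the effective bulk modulus K̃ = K / g(Φ) satisfies K̃ = K(1 − d_H) / (1 − (1 − η)d_H). Moreover, for η > 0 this expression extends continuously to d_H = 1 with value 0, i.e., K̃ vanishes exactly when the hydrostatic damage d_H reaches 1. -/

import Mathlib

open Matrix Filter

/-- **Effective bulk modulus in equi-triaxial tension.** With `Φ = (1−d_H)^{−1/2} Id` and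
`g(Φ) = (1−η) + η[(1/10)(tr Φ)² + (1/30)tr(Φ²)]`, the effective bulk modulus `K̃ = K/g(Φ)`
equals `K(1−d_H)/(1−(1−η)d_H)`; for `η > 0` this expression tends to `0` as `d_H → 1⁻`,
i.e. `K̃` vanishes exactly when the hydrostatic damage reaches `1`. -/
theorem effective_bulk_modulus_equitriaxial
    (K η dH : ℝ) (hK : 0 < K) (h0 : 0 ≤ dH) (h1 : dH < 1)
    (Φ : Matrix (Fin 3) (Fin 3) ℝ)
    (hΦ : Φ = ((1 - dH) ^ (-(1 / 2) : ℝ)) • (1 : Matrix (Fin 3) (Fin 3) ℝ))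
    (g : ℝ)
    (hg : g = (1 - η) + η * (1 / 10 * Φ.trace ^ 2 + 1 / 30 * (Φ * Φ).trace)) :
    K / g = K * (1 - dH) / (1 - (1 - η) * dH) ∧
      (0 < η →
        Tendsto (fun d : ℝ => K * (1 - d) / (1 - (1 - η) * d))
          (nhdsWithin 1 (Set.Ico 0 1)) (nhds 0)) := by
  constructor
  · have hpos : 0 < 1 - dH := sub_pos.2 h1
    have hsq : ((1 - dH) ^ (-(1 / 2) : ℝ)) ^ 2 = (1 - dH)⁻¹ := by
      rw [← Real.rpow_natCast, ← Real.rpow_mul hpos.le, ← Real.rpow_neg_one]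
      norm_num
    have hg' : g = (1 - (1 - η) * dH) / (1 - dH) := by
      have hg_sq : g = (1 - η) + η * ((1 - dH) ^ (-(1 / 2) : ℝ)) ^ 2 := by
        rw [hg, hΦ]
        simp only [smul_mul_smul_comm, mul_one, trace_smul, trace_one, Fintype.card_fin,
          smul_eq_mul]
        push_cast
        ring
      rw [hg_sq, hsq]
      field_simp
      ring
    rw [hg', div_div_eq_mul_div]
  · intro hη
    have hcont : ContinuousAt (fun d : ℝ => K * (1 - d) / (1 - (1 - η) * d)) 1 := by
      refine ContinuousAt.div (by fun_prop) (by fun_prop) ?_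
      simpa using hη.ne'
    simpa using hcont.tendsto.mono_left nhdsWithin_le_nhds
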